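/- Every integrable Lévy process is a harness: let (ξ_t)_{t≥0} be a real-valued process with càdlàg paths, ξ_0 = 0 a.s., stationary independent increments (for s ≤ t, ξ_t − ξ_s is independent of σ(ξ_r : r ≤ s) and distributed as ξ_{t−s}), and E[|ξ_t|] < ∞ for all t. Then for all 0 ≤ s < t < u, E[ξ_t | F_{s,u}] = ((u−t) ξ_s + (t−s) ξ_u)/(u−s) almost surely, where F_{s,u} := σ(ξ_r : r ≤ s) ∨ σ(ξ_v : v ≥ u). -/

import Mathlib

open MeasureTheory ProbabilityTheory Filter Set

/-- The past-future σ-field `σ(ξ_r : 0 ≤ r ≤ s) ⊔ σ(ξ_v : v ≥ u)`. -/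
def pastFuture {Ω : Type*} [MeasurableSpace Ω] (ξ : ℝ → Ω → ℝ) (s u : ℝ) :
    MeasurableSpace Ω :=
  (⨆ r ∈ Set.Icc (0 : ℝ) s, MeasurableSpace.comap (ξ r) inferInstance) ⊔
    (⨆ v ∈ Set.Ici u, MeasurableSpace.comap (ξ v) inferInstance)

/-- A real-valued function on `[0,∞)` is càdlàg: right-continuous with left limits. -/
def CadlagOn (x : ℝ → ℝ) : Prop :=
  (∀ t : ℝ, 0 ≤ t → ContinuousWithinAt x (Set.Ici t) t) ∧
  (∀ t : ℝ, 0 < t → ∃ l : ℝ, Filter.Tendsto x (nhdsWithin t (Set.Iio t)) (nhds l))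

/-- An integrable Lévy process: a measurable real-valued process with a.s. càdlàg paths,
`ξ_0 = 0` a.s., increments `ξ_t − ξ_s` independent of `σ(ξ_r : r ≤ s)` and distributed as
`ξ_{t−s}`, and `E[|ξ_t|] < ∞` for all `t ≥ 0`. -/
structure IsIntegrableLevy {Ω : Type*} [MeasurableSpace Ω] (μ : Measure Ω)
    (ξ : ℝ → Ω → ℝ) : Prop where
  meas : ∀ t : ℝ, Measurable (ξ t)
  zero : ∀ᵐ ω ∂μ, ξ 0 ω = 0
  cadlag : ∀ᵐ ω ∂μ, CadlagOn fun t => ξ t ω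
  indep : ∀ s t : ℝ, 0 ≤ s → s ≤ t →
    Indep (MeasurableSpace.comap (fun ω => ξ t ω - ξ s ω) inferInstance)
      (⨆ r ∈ Set.Icc (0 : ℝ) s, MeasurableSpace.comap (ξ r) inferInstance) μ
  stationary : ∀ s t : ℝ, 0 ≤ s → s ≤ t →
    μ.map (fun ω => ξ t ω - ξ s ω) = μ.map (ξ (t - s))
  integrable : ∀ t : ℝ, 0 ≤ t → Integrable (ξ t) μ


theorem isPi_inter {Ω : Type*} (m₁ m₂ : MeasurableSpace Ω) :
    IsPiSystem {F : Set Ω | ∃ A B, MeasurableSet[m₁] A ∧ MeasurableSet[m₂] B ∧ F = A ∩ B} := by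
  rintro _ ⟨A, B, hA, hB, rfl⟩ _ ⟨A', B', hA', hB', rfl⟩ _
  refine ⟨A ∩ A', B ∩ B', hA.inter hA', hB.inter hB', ?_⟩
  ext x; simp; tauto

theorem gen_inter {Ω : Type*} (m₁ m₂ : MeasurableSpace Ω) :
    m₁ ⊔ m₂ = MeasurableSpace.generateFrom
      {F : Set Ω | ∃ A B, MeasurableSet[m₁] A ∧ MeasurableSet[m₂] B ∧ F = A ∩ B} := by
  apply le_antisymm
  · apply sup_le
    · intro A hA
      exact MeasurableSpace.measurableSet_generateFrom ⟨A, univ, hA, MeasurableSet.univ, by simp⟩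
    · intro A hA
      exact MeasurableSpace.measurableSet_generateFrom ⟨univ, A, MeasurableSet.univ, hA, by simp⟩
  · apply MeasurableSpace.generateFrom_le
    rintro _ ⟨A, B, hA, hB, rfl⟩
    have h1 : MeasurableSet[m₁ ⊔ m₂] A := (le_sup_left : m₁ ≤ m₁ ⊔ m₂) _ hA
    have h2 : MeasurableSet[m₁ ⊔ m₂] B := (le_sup_right : m₂ ≤ m₁ ⊔ m₂) _ hB
    exact h1.inter h2

theorem indep_three {Ω : Type*} [m0 : MeasurableSpace Ω] {μ : Measure Ω} [IsProbabilityMeasure μ]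
    {m₁ m₂ m₃ : MeasurableSpace Ω} (h₁ : m₁ ≤ m0) (h₂ : m₂ ≤ m0) (h₃ : m₃ ≤ m0)
    (h12 : Indep m₁ m₂ μ) (h123 : Indep (m₁ ⊔ m₂) m₃ μ) : Indep m₁ (m₂ ⊔ m₃) μ := by
  refine IndepSets.indep h₁ (sup_le h₂ h₃)
    (@MeasurableSpace.isPiSystem_measurableSet Ω m₁) (isPi_inter m₂ m₃)
    (@MeasurableSpace.generateFrom_measurableSet Ω m₁).symm (gen_inter m₂ m₃) ?_
  rw [IndepSets_iff]
  rintro A _ hA ⟨B, C, hB, hC, rfl⟩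
  rw [Indep_iff] at h12 h123
  have hA' : MeasurableSet[m₁ ⊔ m₂] A := (le_sup_left : m₁ ≤ m₁ ⊔ m₂) _ hA
  have hB' : MeasurableSet[m₁ ⊔ m₂] B := (le_sup_right : m₂ ≤ m₁ ⊔ m₂) _ hB
  rw [← inter_assoc, h123 _ _ (hA'.inter hB') hC, h12 _ _ hA hB, h123 _ _ hB' hC, mul_assoc]

theorem zero_sup {Ω : Type*} [m0 : MeasurableSpace Ω] {μ : Measure Ω} [IsProbabilityMeasure μ]
    {m' m₁ n : MeasurableSpace Ω} (h' : m' ≤ m₁) (h₁ : m₁ ≤ m0) (hn : n ≤ m0)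
    (hi : Indep m₁ n μ) {W : Ω → ℝ} (hW : StronglyMeasurable[m₁] W) (hWi : Integrable W μ)
    (h0 : ∀ B, MeasurableSet[m'] B → ∫ ω in B, W ω ∂μ = 0) :
    ∀ F, MeasurableSet[m' ⊔ n] F → ∫ ω in F, W ω ∂μ = 0 := by
  have hle : m' ⊔ n ≤ m0 := sup_le (h'.trans h₁) hn
  have huniv : ∫ ω, W ω ∂μ = 0 := by simpa using h0 univ MeasurableSet.univ
  intro F hF
  induction F, hF using MeasurableSpace.induction_on_inter (gen_inter m' n) (isPi_inter m' n) with
  | empty => simp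
  | basic F hF =>
    obtain ⟨B, C, hB, hC, rfl⟩ := hF
    have hB0 : MeasurableSet[m0] B := h₁ _ (h' _ hB)
    have e := condExp_indep_eq h₁ hn (hW.indicator (h' _ hB)) hi
    rw [inter_comm, ← setIntegral_indicator hB0]
    rw [← setIntegral_condExp hn (hWi.indicator hB0) hC]
    rw [setIntegral_congr_ae (g := fun _ => (0:ℝ)) (hn _ hC)]
    · simp
    · filter_upwards [e] with ω hω _
      rw [hω, integral_indicator hB0, h0 B hB]
  | compl F hF ih =>
    rw [setIntegral_compl (hle _ hF) hWi, ih, huniv, sub_zero]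
  | iUnion f hd hf ih =>
    rw [integral_iUnion (fun i => hle _ (hf i)) hd hWi.integrableOn]
    simp [ih]

@[reducible] def past {Ω : Type*} (ξ : ℝ → Ω → ℝ) (s : ℝ) : MeasurableSpace Ω :=
  ⨆ r ∈ Set.Icc (0 : ℝ) s, MeasurableSpace.comap (ξ r) inferInstance

@[reducible] def incr {Ω : Type*} (ξ : ℝ → Ω → ℝ) (s t : ℝ) : MeasurableSpace Ω :=
  MeasurableSpace.comap (fun ω => ξ t ω - ξ s ω) inferInstance

@[reducible] def future {Ω : Type*} (ξ : ℝ → Ω → ℝ) (T : ℝ) : MeasurableSpace Ω :=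
  ⨆ v ∈ Set.Ici T, incr ξ T v

theorem meas_past {Ω : Type*} (ξ : ℝ → Ω → ℝ) {r s : ℝ} (h0 : 0 ≤ r) (h : r ≤ s) :
    Measurable[past ξ s] (ξ r) := by
  rw [measurable_iff_comap_le]
  exact le_iSup₂_of_le r ⟨h0, h⟩ le_rfl

theorem incr_le_past {Ω : Type*} (ξ : ℝ → Ω → ℝ) {p q s : ℝ} (h0 : 0 ≤ p) (hq : 0 ≤ q)
    (h : p ≤ s) (h' : q ≤ s) : incr ξ p q ≤ past ξ s :=
  measurable_iff_comap_le.1 ((meas_past ξ hq h').sub (meas_past ξ h0 h))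

theorem past_mono {Ω : Type*} (ξ : ℝ → Ω → ℝ) {s t : ℝ} (h : s ≤ t) : past ξ s ≤ past ξ t :=
  iSup₂_le fun r hr => measurable_iff_comap_le.1 (meas_past ξ hr.1 (hr.2.trans h))

namespace IsIntegrableLevy

variable {Ω : Type*} [m0 : MeasurableSpace Ω] {μ : Measure Ω} [IsProbabilityMeasure μ]
    {ξ : ℝ → Ω → ℝ}

theorem past_le (hξ : IsIntegrableLevy μ ξ) (s : ℝ) : past ξ s ≤ m0 :=
  iSup₂_le fun r _ => measurable_iff_comap_le.1 (hξ.meas r)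

theorem incr_le (hξ : IsIntegrableLevy μ ξ) (s t : ℝ) : incr ξ s t ≤ m0 :=
  measurable_iff_comap_le.1 ((hξ.meas t).sub (hξ.meas s))

theorem indep_incr (hξ : IsIntegrableLevy μ ξ) {s t : ℝ} (hs : 0 ≤ s) (h : s ≤ t) :
    Indep (past ξ s) (incr ξ s t) μ := (hξ.indep s t hs h).symm

theorem indep_fin (hξ : IsIntegrableLevy μ ξ) {T : ℝ} (hT : 0 ≤ T) (S : Finset ℝ) :
    (∀ v ∈ S, T ≤ v) → Indep (past ξ T) (⨆ v ∈ S, incr ξ T v) μ := by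
  induction S using Finset.induction_on_max with
  | empty => intro _; simpa using indep_bot_right _
  | insert a S hS ih =>
    intro h
    have ih := ih (fun v hv => h v (Finset.mem_insert_of_mem hv))
    have hTa : T ≤ a := h a (Finset.mem_insert_self _ _)
    obtain ⟨w, hwm, hw⟩ : ∃ w ∈ insert T S, ∀ v ∈ insert T S, v ≤ w :=
      ⟨_, Finset.max'_mem _ (Finset.insert_nonempty T S), fun v hv => Finset.le_max' _ _ hv⟩
    have hTw : T ≤ w := hw T (Finset.mem_insert_self _ _)
    have hwa : w ≤ a := by
      rcases Finset.mem_insert.1 hwm with h | h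
      · rw [h]; exact hTa
      · exact (hS w h).le
    have hle : (⨆ v ∈ S, incr ξ T v) ≤ past ξ w := iSup₂_le fun v hv =>
      incr_le_past ξ hT (hT.trans (h v (Finset.mem_insert_of_mem hv))) hTw
        (hw v (Finset.mem_insert_of_mem hv))
    have h3 := indep_three (hξ.past_le T) (hle.trans (hξ.past_le w)) (hξ.incr_le w a) ih
      (indep_of_indep_of_le_left (hξ.indep_incr (hT.trans hTw) hwa)
        (sup_le (past_mono ξ hTw) hle))
    refine indep_of_indep_of_le_right h3 ?_
    rw [Finset.iSup_insert]
    refine sup_le ?_ le_sup_left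
    set M := (⨆ v ∈ S, incr ξ T v) ⊔ incr ξ w a with hM
    have m1 : Measurable[M] (fun ω => ξ a ω - ξ w ω) :=
      measurable_iff_comap_le.2 le_sup_right
    have m2 : Measurable[M] (fun ω => ξ w ω - ξ T ω) := by
      rcases Finset.mem_insert.1 hwm with h | h
      · rw [h]; simp
      · exact measurable_iff_comap_le.2 (le_sup_of_le_left (le_iSup₂_of_le w h le_rfl))
    refine measurable_iff_comap_le.1 ?_
    have := m1.add m2
    convert this using 1
    ext ω; simp

theorem indep_future (hξ : IsIntegrableLevy μ ξ) {T : ℝ} (hT : 0 ≤ T) :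
    Indep (past ξ T) (future ξ T) μ := by
  have : future ξ T = ⨆ S : Finset (Set.Ici T), ⨆ v ∈ S.map (Function.Embedding.subtype _),
      incr ξ T v := by
    apply le_antisymm
    · refine iSup₂_le fun v hv => ?_
      refine le_iSup_of_le {⟨v, hv⟩} ?_
      simp
    · refine iSup_le fun S => iSup₂_le fun v hv => ?_
      simp at hv
      exact le_iSup₂_of_le v hv.1 le_rfl
  rw [this]
  refine (indep_iSup_of_directed_le (fun S => (hξ.indep_fin hT _ ?_).symm) (fun S =>
    iSup₂_le fun v _ => hξ.incr_le _ _) (hξ.past_le T) ?_).symm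
  · intro v hv
    simp at hv
    exact hv.1
  · apply Monotone.directed_le
    intro S S' h
    refine iSup₂_le fun v hv => le_iSup₂_of_le v ?_ le_rfl
    exact Finset.map_subset_map.2 h hv

theorem future_le (hξ : IsIntegrableLevy μ ξ) (s : ℝ) : future ξ s ≤ m0 :=
  iSup₂_le fun r _ => hξ.incr_le _ _

end IsIntegrableLevy

theorem additive_linear {φ : ℝ → ℝ} {h δ K : ℝ} (hh : 0 < h) (hδ : 0 < δ)
    (hadd : ∀ a b, 0 ≤ a → 0 ≤ b → a + b ≤ h → φ (a + b) = φ a + φ b)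
    (hb : ∀ a, 0 ≤ a → a ≤ δ → a ≤ h → |φ a| ≤ K) (a : ℝ) (ha : 0 ≤ a) (hah : a ≤ h) :
    φ a = a / h * φ h := by
  have h0 : φ 0 = 0 := by
    have := hadd 0 0 le_rfl le_rfl (by simpa using hh.le)
    simp at this
    exact this
  have hmul : ∀ (n : ℕ) (x : ℝ), 0 ≤ x → n * x ≤ h → φ (n * x) = n * φ x := by
    intro n x hx
    induction n with
    | zero => intro _; simp [h0]
    | succ n ih =>
      intro hn
      push_cast at hn ⊢
      have e : ((n : ℝ) + 1) * x = n * x + x := by ring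
      rw [e] at hn ⊢
      rw [hadd _ _ (by positivity) hx hn, ih (by linarith)]
      ring
  obtain ⟨N, hN⟩ := exists_nat_gt (h / δ)
  have hN0 : (0 : ℝ) < N := lt_trans (by positivity) hN
  have hNδ : h ≤ N * δ := by
    rw [div_lt_iff₀ hδ] at hN; exact hN.le
  have hNn : N ≠ 0 := by rintro rfl; simp at hN0
  set δ' := min δ h
  have key : ∀ j : ℕ, 0 < j → |φ a - a / h * φ h| ≤ (|φ h| + K) / j := by
    intro j hj
    have hj' : (0 : ℝ) < j := by exact_mod_cast hj
    set n : ℕ := N * j with hn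
    have hn0 : (0 : ℝ) < n := by rw [hn]; push_cast; positivity
    set e : ℝ := h / n with he
    have hepos : 0 < e := by positivity
    set k : ℕ := ⌊a / e⌋₊ with hk
    have hk1 : (k : ℝ) * e ≤ a := by
      rw [← le_div_iff₀ hepos]; exact Nat.floor_le (by positivity)
    have hk2 : a < (k + 1) * e := by
      rw [← div_lt_iff₀ hepos]; exact Nat.lt_floor_add_one _
    set r := a - k * e with hr
    have hr0 : 0 ≤ r := by linarith
    have hre : r ≤ e := by nlinarith
    have hne : (n : ℝ) * e = h := by rw [he]; field_simp
    have hφe : φ h = n * φ e := by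
      rw [← hmul n e hepos.le hne.le, hne]
    have hφa : φ a = k * φ e + φ r := by
      rw [← hmul k e hepos.le (hk1.trans hah), ← hadd _ _ (by positivity) hr0 (by linarith)]
      congr 1; rw [hr]; ring
    have hje : (j : ℝ) * e ≤ δ ∧ (j : ℝ) * e ≤ h := by
      have : (j : ℝ) * e = h / N := by rw [he, hn]; push_cast; field_simp
      rw [this]
      refine ⟨by rw [div_le_iff₀ hN0]; linarith, div_le_self hh.le ?_⟩
      exact_mod_cast Nat.one_le_iff_ne_zero.2 hNn
    have hjr : (j : ℝ) * r ≤ j * e := by gcongr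
    have hφr : |φ r| ≤ K / j := by
      rw [le_div_iff₀ hj']
      have := hb (j * r) (by positivity) (by linarith) (by linarith)
      rw [hmul j r hr0 (by linarith), abs_mul, abs_of_pos hj'] at this
      linarith
    have hd : φ a - a / h * φ h = φ r - r / h * φ h := by
      have : (k : ℝ) * φ e = k * e / h * φ h := by
        rw [hφe, ← hne]; field_simp
      rw [hφa, this, hr]; ring
    have hrh : r / h ≤ 1 / j := by
      rw [div_le_div_iff₀ hh hj']; linarith
    rw [hd]
    calc |φ r - r / h * φ h| ≤ |φ r| + |r / h * φ h| := abs_sub _ _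
      _ = |φ r| + r / h * |φ h| := by rw [abs_mul, abs_of_nonneg (by positivity : 0 ≤ r / h)]
      _ ≤ K / j + 1 / j * |φ h| := by gcongr
      _ = _ := by ring
  have hlim : Tendsto (fun j : ℕ => (|φ h| + K) / (j : ℝ)) atTop (nhds 0) :=
    tendsto_const_div_atTop_nhds_zero_nat _
  have : |φ a - a / h * φ h| ≤ 0 := by
    refine ge_of_tendsto hlim ?_
    filter_upwards [eventually_gt_atTop 0] with j hj using key j hj
  have := abs_nonpos_iff.1 this
  linarith

namespace IsIntegrableLevy

variable {Ω : Type*} [m0 : MeasurableSpace Ω] {μ : Measure Ω} [IsProbabilityMeasure μ]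
    {ξ : ℝ → Ω → ℝ}

theorem map_conv (hξ : IsIntegrableLevy μ ξ) {a b : ℝ} (ha : 0 ≤ a) (hb : 0 ≤ b) :
    μ.map (ξ (a + b)) = (μ.map (ξ a)) ∗ (μ.map (ξ b)) := by
  have hi : IndepFun (ξ a) (fun ω => ξ (a + b) ω - ξ a ω) μ :=
    indep_of_indep_of_le_left (hξ.indep_incr ha (by linarith : a ≤ a + b))
      (measurable_iff_comap_le.1 (meas_past ξ ha le_rfl))
  have mD : Measurable (fun ω => ξ (a + b) ω - ξ a ω) := (hξ.meas _).sub (hξ.meas a)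
  have := hi.map_add_eq_map_conv_map (hξ.meas a) mD
  rw [hξ.stationary a (a + b) ha (by linarith)] at this
  rw [add_sub_cancel_left] at this
  rw [← this]
  congr 1
  ext ω; simp

theorem law_pair (hξ : IsIntegrableLevy μ ξ) {s p q u : ℝ} (hs : 0 ≤ s) (hsp : s ≤ p)
    (hpq : p ≤ q) (hqu : q ≤ u) :
    μ.map (fun ω => (ξ q ω - ξ p ω, (ξ p ω - ξ s ω) + (ξ u ω - ξ q ω))) =
      (μ.map (ξ (q - p))).prod (μ.map (ξ ((u - s) - (q - p)))) := by
  have hp := hs.trans hsp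
  have hq := hp.trans hpq
  have hu := hq.trans hqu
  have mD : Measurable (fun ω => ξ q ω - ξ p ω) := (hξ.meas q).sub (hξ.meas p)
  have mA : Measurable (fun ω => ξ p ω - ξ s ω) := (hξ.meas p).sub (hξ.meas s)
  have mC : Measurable (fun ω => ξ u ω - ξ q ω) := (hξ.meas u).sub (hξ.meas q)
  have mAC : Measurable (fun ω => (ξ p ω - ξ s ω) + (ξ u ω - ξ q ω)) := mA.add mC
  have i1 : Indep (incr ξ p q) (incr ξ s p) μ :=
    (indep_of_indep_of_le_left (hξ.indep_incr hp hpq) (incr_le_past ξ hs hp hsp le_rfl)).symm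
  have i2 : Indep (incr ξ p q ⊔ incr ξ s p) (incr ξ q u) μ :=
    indep_of_indep_of_le_left (hξ.indep_incr hq hqu)
      (sup_le (incr_le_past ξ hp hq hpq le_rfl) (incr_le_past ξ hs hp (hsp.trans hpq) hpq))
  have i3 := indep_three (hξ.incr_le p q) (hξ.incr_le s p) (hξ.incr_le q u) i1 i2
  have i4 : IndepFun (fun ω => ξ q ω - ξ p ω)
      (fun ω => (ξ p ω - ξ s ω) + (ξ u ω - ξ q ω)) μ := by
    refine indep_of_indep_of_le_right i3 ?_
    refine measurable_iff_comap_le.1 (Measurable.add ?_ ?_)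
    · exact measurable_iff_comap_le.2 le_sup_left
    · exact measurable_iff_comap_le.2 le_sup_right
  have i5 : IndepFun (fun ω => ξ p ω - ξ s ω) (fun ω => ξ u ω - ξ q ω) μ :=
    indep_of_indep_of_le_left i2 le_sup_right
  rw [(indepFun_iff_map_prod_eq_prod_map_map mD.aemeasurable
    mAC.aemeasurable).1 i4]
  congr 1
  · exact hξ.stationary p q hp hpq
  · have := i5.map_add_eq_map_conv_map mA mC
    rw [hξ.stationary s p hs hsp, hξ.stationary q u hq hqu,
      ← hξ.map_conv (by linarith) (by linarith)] at this
    rw [show u - s - (q - p) = p - s + (u - q) by ring, ← this]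
    rfl

theorem setInt_eq (hξ : IsIntegrableLevy μ ξ) {s p q u : ℝ} (hs : 0 ≤ s) (hsp : s ≤ p)
    (hpq : p ≤ q) (hqu : q ≤ u) {B : Set ℝ} (hB : MeasurableSet B) :
    ∫ ω in (fun ω => ξ u ω - ξ s ω) ⁻¹' B, (ξ q ω - ξ p ω) ∂μ =
      ∫ z, {z : ℝ × ℝ | z.1 + z.2 ∈ B}.indicator (fun z => z.1) z
        ∂((μ.map (ξ (q - p))).prod (μ.map (ξ ((u - s) - (q - p))))) := by
  have mD : Measurable (fun ω => ξ q ω - ξ p ω) := (hξ.meas q).sub (hξ.meas p)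
  have mA : Measurable (fun ω => ξ p ω - ξ s ω) := (hξ.meas p).sub (hξ.meas s)
  have mC : Measurable (fun ω => ξ u ω - ξ q ω) := (hξ.meas u).sub (hξ.meas q)
  have mAC : Measurable (fun ω => (ξ p ω - ξ s ω) + (ξ u ω - ξ q ω)) := mA.add mC
  have mY : Measurable (fun ω => ξ u ω - ξ s ω) := (hξ.meas u).sub (hξ.meas s)
  rw [← hξ.law_pair hs hsp hpq hqu, integral_map (mD.prodMk mAC).aemeasurable,
    ← integral_indicator (mY hB)]
  · congr 1
    ext ω
    have e : ξ q ω - ξ p ω + (ξ p ω - ξ s ω + (ξ u ω - ξ q ω)) = ξ u ω - ξ s ω := by ring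
    by_cases hm : ξ u ω - ξ s ω ∈ B
    · rw [Set.indicator_of_mem (show ω ∈ (fun ω => ξ u ω - ξ s ω) ⁻¹' B from hm),
        Set.indicator_of_mem]
      change _ + _ ∈ B
      rw [e]; exact hm
    · rw [Set.indicator_of_notMem (show ω ∉ (fun ω => ξ u ω - ξ s ω) ⁻¹' B from hm),
        Set.indicator_of_notMem]
      change ¬ (_ + _ ∈ B)
      rw [e]; exact hm
  · exact (measurable_fst.indicator
      ((measurable_fst.add measurable_snd) hB)).aestronglyMeasurable

theorem centred_le (hξ : IsIntegrableLevy μ ξ) {a : ℝ} (ha : 0 ≤ a) (ha1 : a ≤ 1) :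
    ∫ ω, |ξ a ω - ∫ ω', ξ a ω' ∂μ| ∂μ ≤ ∫ ω, |ξ 1 ω - ∫ ω', ξ 1 ω' ∂μ| ∂μ := by
  have ia := hξ.integrable a ha
  have i1 := hξ.integrable 1 zero_le_one
  have hle := hξ.past_le a
  have e : μ[fun ω => ξ 1 ω - ∫ ω', ξ 1 ω' ∂μ | past ξ a] =ᵐ[μ]
      fun ω => ξ a ω - ∫ ω', ξ a ω' ∂μ := by
    have e1 := condExp_indep_eq (hξ.incr_le a 1) hle
      (f := fun ω => ξ 1 ω - ξ a ω)
      (measurable_iff_comap_le.2 le_rfl : Measurable[incr ξ a 1] _).stronglyMeasurable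
      (hξ.indep_incr ha ha1).symm
    have e2 := condExp_sub i1 ia (past ξ a)
    have e3 := condExp_of_stronglyMeasurable hle (meas_past ξ ha le_rfl).stronglyMeasurable ia
    have e4 := condExp_sub i1 (integrable_const (∫ ω', ξ 1 ω' ∂μ)) (past ξ a)
    have e5 := condExp_const hle (∫ ω', ξ 1 ω' ∂μ) (μ := μ)
    rw [integral_sub i1 ia] at e1
    rw [e3] at e2
    rw [e5] at e4
    filter_upwards [e1, e2, e4] with ω h1 h2 h4
    have h2' : (μ[fun ω => ξ 1 ω - ξ a ω | past ξ a]) ω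
      = (μ[ξ 1 | past ξ a]) ω - ξ a ω := h2
    have h4' : (μ[fun ω => ξ 1 ω - ∫ ω', ξ 1 ω' ∂μ | past ξ a]) ω
      = (μ[ξ 1 | past ξ a]) ω - ∫ ω', ξ 1 ω' ∂μ := h4
    rw [h4']
    linarith
  calc _ = ∫ ω, |(μ[fun ω => ξ 1 ω - ∫ ω', ξ 1 ω' ∂μ | past ξ a]) ω| ∂μ := by
        apply integral_congr_ae
        filter_upwards [e] with ω h
        rw [h]
    _ ≤ _ := integral_abs_condExp_le _

theorem bdd (hξ : IsIntegrableLevy μ ξ) :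
    ∃ δ K : ℝ, 0 < δ ∧ ∀ a, 0 ≤ a → a ≤ δ → ∫ ω, |ξ a ω| ∂μ ≤ K := by
  by_contra! hcon
  set C := ∫ ω, |ξ 1 ω - ∫ ω', ξ 1 ω' ∂μ| ∂μ with hC
  have : ∀ n : ℕ, ∃ a, 0 ≤ a ∧ a ≤ 1 / ((n : ℝ) + 1) ∧ C + n < ∫ ω, |ξ a ω| ∂μ :=
    fun n => hcon _ _ (by positivity)
  choose a ha0 ha1 ha2 using this
  have ha1' : ∀ n, a n ≤ 1 := fun n => (ha1 n).trans
    (by rw [div_le_one (by positivity)]; linarith [(Nat.cast_nonneg n : (0:ℝ) ≤ n)])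
  set m : ℕ → ℝ := fun n => ∫ ω, ξ (a n) ω ∂μ with hm
  have hcent : ∀ n, ∫ ω, |ξ (a n) ω - m n| ∂μ ≤ C := fun n => hξ.centred_le (ha0 n) (ha1' n)
  have hint : ∀ n, Integrable (fun ω => ξ (a n) ω - m n) μ :=
    fun n => (hξ.integrable _ (ha0 n)).sub (integrable_const _)
  have hmn : ∀ n : ℕ, (n : ℝ) ≤ |m n| := by
    intro n
    have h1 : ∫ ω, |ξ (a n) ω| ∂μ ≤ ∫ ω, (|ξ (a n) ω - m n| + |m n|) ∂μ := by
      apply integral_mono (hξ.integrable _ (ha0 n)).abs ((hint n).abs.add (integrable_const _))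
      intro ω
      have := abs_add_le (ξ (a n) ω - m n) (m n)
      simpa using this
    rw [integral_add (hint n).abs (integrable_const _)] at h1
    simp at h1
    linarith [ha2 n, hcent n]
  have hat : Tendsto a atTop (nhdsWithin 0 (Set.Ici 0)) := by
    rw [tendsto_nhdsWithin_iff]
    refine ⟨squeeze_zero ha0 ha1 tendsto_one_div_add_atTop_nhds_zero_nat, ?_⟩
    exact Eventually.of_forall ha0
  have hF := lintegral_liminf_le (μ := μ) (u := atTop)
    (f := fun n ω => ENNReal.ofReal |ξ (a n) ω - m n|)
    (fun n => (((hξ.meas (a n)).sub_const _).abs).ennreal_ofReal)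
  have hl : ∀ᵐ ω ∂μ, liminf (fun n => ENNReal.ofReal |ξ (a n) ω - m n|) atTop = ⊤ := by
    filter_upwards [hξ.zero, hξ.cadlag] with ω h0 hc
    apply Tendsto.liminf_eq
    refine ENNReal.tendsto_ofReal_atTop.comp ?_
    have t1 : Tendsto (fun n => ξ (a n) ω) atTop (nhds 0) := by
      have := (hc.1 0 le_rfl).tendsto.comp hat
      simpa [h0, Function.comp_def] using this
    have t2 : Tendsto (fun n => |m n|) atTop atTop :=
      tendsto_atTop_mono hmn tendsto_natCast_atTop_atTop
    have t3 : Tendsto (fun n => |m n| + -|ξ (a n) ω|) atTop atTop :=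
      t2.atTop_add (t1.abs.neg)
    refine tendsto_atTop_mono (fun n => ?_) t3
    have := abs_sub_abs_le_abs_sub (m n) (ξ (a n) ω)
    rw [abs_sub_comm] at this
    linarith
  rw [lintegral_congr_ae hl] at hF
  have hF2 : liminf (fun n => ∫⁻ ω, ENNReal.ofReal |ξ (a n) ω - m n| ∂μ) atTop
      ≤ ENNReal.ofReal C := by
    refine liminf_le_of_le (by isBoundedDefault) fun b hb => ?_
    obtain ⟨n, hn⟩ := hb.exists
    refine hn.trans ?_
    rw [← ofReal_integral_eq_lintegral_ofReal (hint n).abs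
      (Eventually.of_forall fun ω => abs_nonneg _)]
    exact ENNReal.ofReal_le_ofReal (hcent n)
  have := hF.trans hF2
  simp at this

theorem step_one (hξ : IsIntegrableLevy μ ξ) {s t u : ℝ} (hs : 0 ≤ s) (hst : s < t)
    (htu : t < u) {B : Set ℝ} (hB : MeasurableSet B) :
    ∫ ω in (fun ω => ξ u ω - ξ s ω) ⁻¹' B, (ξ t ω - ξ s ω) ∂μ =
      (t - s) / (u - s) * ∫ ω in (fun ω => ξ u ω - ξ s ω) ⁻¹' B, (ξ u ω - ξ s ω) ∂μ := by
  obtain ⟨δ, K, hδ, hK⟩ := hξ.bdd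
  have hI : ∀ p q, 0 ≤ p → 0 ≤ q → Integrable (fun ω => ξ q ω - ξ p ω) μ :=
    fun p q hp hq => (hξ.integrable q hq).sub (hξ.integrable p hp)
  have := additive_linear
    (φ := fun a => ∫ ω in (fun ω => ξ u ω - ξ s ω) ⁻¹' B, (ξ (s + a) ω - ξ s ω) ∂μ)
    (h := u - s) (δ := δ) (K := K) (by linarith) hδ ?_ ?_ (t - s) (by linarith) (by linarith)
  · simpa using this
  · intro a b ha hb hab
    have e1 := hξ.setInt_eq hs le_rfl (by linarith : s ≤ s + b) (by linarith : s + b ≤ u) hB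
    have e2 := hξ.setInt_eq hs (by linarith : s ≤ s + a) (by linarith : s + a ≤ s + (a + b))
      (by linarith : s + (a + b) ≤ u) hB
    rw [show s + (a + b) - (s + a) = s + b - s by ring, ← e1] at e2
    rw [← e2, ← integral_add (hI _ _ hs (by linarith)).integrableOn
      (hI _ _ (by linarith) (by linarith)).integrableOn]
    congr 1
    ext ω; ring
  · intro a ha haδ hah
    have hi := hI s (s + a) hs (by linarith)
    calc |∫ ω in (fun ω => ξ u ω - ξ s ω) ⁻¹' B, (ξ (s + a) ω - ξ s ω) ∂μ|
        ≤ ∫ ω in (fun ω => ξ u ω - ξ s ω) ⁻¹' B, |ξ (s + a) ω - ξ s ω| ∂μ :=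
          abs_integral_le_integral_abs
      _ ≤ ∫ ω, |ξ (s + a) ω - ξ s ω| ∂μ :=
          setIntegral_le_integral hi.abs (Eventually.of_forall fun _ => abs_nonneg _)
      _ = ∫ x, |x| ∂(μ.map (fun ω => ξ (s + a) ω - ξ s ω)) := by
          have mD : Measurable (fun ω => ξ (s + a) ω - ξ s ω) := (hξ.meas _).sub (hξ.meas s)
          rw [integral_map mD.aemeasurable
            continuous_abs.aestronglyMeasurable]
      _ = ∫ ω, |ξ a ω| ∂μ := by
          rw [hξ.stationary s (s + a) hs (by linarith), add_sub_cancel_left,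
            integral_map (hξ.meas _).aemeasurable continuous_abs.aestronglyMeasurable]
      _ ≤ K := hK a ha haδ

end IsIntegrableLevy

/-- Every integrable Lévy process is a harness: for all `0 ≤ s < t < u`,
`E[ξ_t | F_{s,u}] = ((u−t) ξ_s + (t−s) ξ_u)/(u−s)` almost surely. -/
theorem integrableLevy_isHarness
    {Ω : Type*} [MeasurableSpace Ω] (μ : Measure Ω) [IsProbabilityMeasure μ]
    (ξ : ℝ → Ω → ℝ) (hξ : IsIntegrableLevy μ ξ) :
    ∀ s t u : ℝ, 0 ≤ s → s < t → t < u →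
      μ[ξ t | pastFuture ξ s u] =ᵐ[μ]
        fun ω => ((u - t) * ξ s ω + (t - s) * ξ u ω) / (u - s) := by
  intro s t u hs hst htu
  have ht : 0 ≤ t := hs.trans hst.le
  have hu : 0 ≤ u := ht.trans htu.le
  have hsu : s ≤ u := (hst.trans htu).le
  have hne : u - s ≠ 0 := by linarith
  have Is := hξ.integrable s hs
  have It := hξ.integrable t ht
  have Iu := hξ.integrable u hu
  set c := (t - s) / (u - s) with hc
  set W : Ω → ℝ := fun ω => (ξ t ω - ξ s ω) - c * (ξ u ω - ξ s ω) with hW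
  have IW : Integrable W μ := (It.sub Is).sub ((Iu.sub Is).const_mul c)
  have w1 : ∀ B, MeasurableSet[incr ξ s u] B → ∫ ω in B, W ω ∂μ = 0 := by
    rintro _ ⟨B, hB, rfl⟩
    have i1 : Integrable (fun ω => ξ t ω - ξ s ω) μ := It.sub Is
    have i2 : Integrable (fun ω => c * (ξ u ω - ξ s ω)) μ := (Iu.sub Is).const_mul c
    rw [hW, integral_sub i1.integrableOn i2.integrableOn, hξ.step_one hs hst htu hB,
      integral_const_mul, sub_self]
  have mt : Measurable[future ξ s] (fun ω => ξ t ω - ξ s ω) :=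
    measurable_iff_comap_le.2 (le_iSup₂_of_le (f := fun v (_ : v ∈ Ici s) => incr ξ s v)
      t hst.le le_rfl)
  have hus : incr ξ s u ≤ future ξ s :=
    le_iSup₂_of_le (f := fun v (_ : v ∈ Ici s) => incr ξ s v) u hsu le_rfl
  have mu : Measurable[future ξ s] (fun ω => ξ u ω - ξ s ω) := measurable_iff_comap_le.2 hus
  have w2 := zero_sup hus (hξ.future_le s) (hξ.past_le s) (hξ.indep_future hs).symm
    (W := W) (mt.sub (mu.const_mul c)).stronglyMeasurable IW w1
  have w3 := zero_sup (sup_le (incr_le_past ξ hs hu hsu le_rfl) (past_mono ξ hsu))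
    (hξ.past_le u) (hξ.future_le u) (hξ.indep_future hu) (W := W)
    (((meas_past ξ ht htu.le).sub (meas_past ξ hs hsu)).sub
      (((meas_past ξ hu le_rfl).sub (meas_past ξ hs hsu)).const_mul c)).stronglyMeasurable IW w2
  have hle : pastFuture ξ s u ≤ (incr ξ s u ⊔ past ξ s) ⊔ future ξ u := by
    set M := (incr ξ s u ⊔ past ξ s) ⊔ future ξ u with hM
    have hp : past ξ s ≤ M := le_sup_of_le_left le_sup_right
    refine sup_le hp (iSup₂_le fun v hv => measurable_iff_comap_le.1 ?_)
    have a1 : Measurable[M] (ξ s) := (meas_past ξ hs le_rfl).mono hp le_rfl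
    have a2 : Measurable[M] (fun ω => ξ u ω - ξ s ω) :=
      measurable_iff_comap_le.2 (le_sup_of_le_left le_sup_left)
    have a3 : Measurable[M] (fun ω => ξ v ω - ξ u ω) :=
      measurable_iff_comap_le.2 (le_sup_of_le_right
        (le_iSup₂_of_le (f := fun v (_ : v ∈ Ici u) => incr ξ u v) v hv le_rfl))
    have := (a1.add a2).add a3
    convert this using 1
    ext ω; simp
  have hle0 : pastFuture ξ s u ≤ ‹MeasurableSpace Ω› :=
    hle.trans (sup_le (sup_le (hξ.incr_le s u) (hξ.past_le s)) (hξ.future_le u))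
  have hg : (fun ω => ((u - t) * ξ s ω + (t - s) * ξ u ω) / (u - s)) =
      fun ω => ξ t ω - W ω := by
    ext ω
    simp only [hW, hc]
    field_simp
    ring
  have ps : Measurable[pastFuture ξ s u] (ξ s) :=
    (meas_past ξ hs le_rfl).mono le_sup_left le_rfl
  have pu : Measurable[pastFuture ξ s u] (ξ u) := by
    refine measurable_iff_comap_le.2 (le_sup_of_le_right ?_)
    exact le_iSup₂_of_le
      (f := fun v (_ : v ∈ Ici u) => MeasurableSpace.comap (ξ v) inferInstance) u
      (Set.mem_Ici.2 le_rfl) le_rfl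
  symm
  refine ae_eq_condExp_of_forall_setIntegral_eq hle0 It ?_ ?_ ?_
  · intro F _ _
    rw [hg]
    exact (It.sub IW).integrableOn
  · intro F hF _
    rw [hg, integral_sub It.integrableOn IW.integrableOn, w3 F (hle F hF), sub_zero]
  · exact (((ps.const_mul _).add (pu.const_mul _)).div_const _).stronglyMeasurable.aestronglyMeasurable
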